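/- Two skew left braces A and B are isoclinic if and only if there exist ideals L ⊆ Ann(A) of A and N ⊆ Ann(B) of B and brace isomorphisms ξ : A/L → B/N and θ : Γ₂(A) → Γ₂(B) such that θ([a₁,a₂]·) = [b₁,b₂]· and θ(a₁*a₂) = b₁*b₂ whenever ξ(L·aᵢ) = N·bᵢ for i = 1,2. -/

import Mathlib

set_option linter.unusedVariables false

universe u v

/-- A skew left brace: a carrier with two group structures `(A,·)` (written `dmul`) and
`(A,∘)` (written `cmul`) sharing the same identity `ident`, satisfying
`a ∘ (b · c) = (a ∘ b) · a⁻¹ · (a ∘ c)`. -/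
class SkewBrace (A : Type u) where
  dmul : A → A → A
  ident : A
  dinv : A → A
  cmul : A → A → A
  cinv : A → A
  dmul_assoc : ∀ a b c : A, dmul (dmul a b) c = dmul a (dmul b c)
  ident_dmul : ∀ a : A, dmul ident a = a
  dmul_ident : ∀ a : A, dmul a ident = a
  dinv_dmul : ∀ a : A, dmul (dinv a) a = ident
  dmul_dinv : ∀ a : A, dmul a (dinv a) = ident
  cmul_assoc : ∀ a b c : A, cmul (cmul a b) c = cmul a (cmul b c)
  ident_cmul : ∀ a : A, cmul ident a = a
  cmul_ident : ∀ a : A, cmul a ident = a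
  cinv_cmul : ∀ a : A, cmul (cinv a) a = ident
  cmul_cinv : ∀ a : A, cmul a (cinv a) = ident
  compat : ∀ a b c : A, cmul a (dmul b c) = dmul (dmul (cmul a b) (dinv a)) (cmul a c)

namespace SkewBrace

variable {A : Type u} [SkewBrace A]

/-- The lambda map `λ_a(b) = a⁻¹ · (a ∘ b)`. -/
def lam (a b : A) : A := dmul (dinv a) (cmul a b)

/-- The star operation `a * b = λ_a(b) · b⁻¹`. -/
def bstar (a b : A) : A := dmul (lam a b) (dinv b)

/-- The dot commutator `[a,b]· = a · b · a⁻¹ · b⁻¹`. -/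
def dcomm (a b : A) : A := dmul (dmul (dmul a b) (dinv a)) (dinv b)

/-- The circle commutator `[a,b]∘ = a ∘ b ∘ ā ∘ b̄`. -/
def ccomm (a b : A) : A := cmul (cmul (cmul a b) (cinv a)) (cinv b)

/-- Membership in the subgroup of `(A,·)` generated by a subset. -/
inductive dclosure (S : Set A) : A → Prop
  | mem {x : A} : x ∈ S → dclosure S x
  | one : dclosure S ident
  | mul {x y : A} : dclosure S x → dclosure S y → dclosure S (dmul x y)
  | inv {x : A} : dclosure S x → dclosure S (dinv x)

/-- The subgroup of `(A,·)` generated by a subset, as a set. -/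
def dcl (S : Set A) : Set A := {x | dclosure S x}

/-- Membership in the subgroup of `(A,∘)` generated by a subset. -/
inductive cclosure (S : Set A) : A → Prop
  | mem {x : A} : x ∈ S → cclosure S x
  | one : cclosure S ident
  | mul {x y : A} : cclosure S x → cclosure S y → cclosure S (cmul x y)
  | inv {x : A} : cclosure S x → cclosure S (cinv x)

/-- The subgroup of `(A,∘)` generated by a subset, as a set. -/
def ccl (S : Set A) : Set A := {x | cclosure S x}

/-- The set `{x * y : x ∈ I, y ∈ J}` (star values). -/
def starSet (I J : Set A) : Set A := {x | ∃ a ∈ I, ∃ b ∈ J, x = bstar a b}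

/-- The set of dot commutators `[a,b]·` with `a ∈ I`, `b ∈ J`. -/
def dcommSet (I J : Set A) : Set A := {x | ∃ a ∈ I, ∃ b ∈ J, x = dcomm a b}

/-- The set of circle commutators `[a,b]∘` with `a ∈ I`, `b ∈ J`. -/
def ccommSet (I J : Set A) : Set A := {x | ∃ a ∈ I, ∃ b ∈ J, x = ccomm a b}

/-- The lower central series `Γ_n(A)` of the skew brace `A` (`Gamma A n = Γ_n(A)` for `n ≥ 1`):
`Γ₁(A) = A` and `Γ_n(A) = ⟨A * Γ_{n-1}(A), Γ_{n-1}(A) * A, [A,Γ_{n-1}(A)]·⟩·`. -/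
def Gamma (A : Type u) [SkewBrace A] : ℕ → Set A
  | 0 => Set.univ
  | 1 => Set.univ
  | (n+2) =>
      dcl (starSet Set.univ (Gamma A (n+1)) ∪ starSet (Gamma A (n+1)) Set.univ ∪
        dcommSet Set.univ (Gamma A (n+1)))

/-- The lower central series `γ_n(A,∘)` of the group `(A,∘)`
(`gammaCirc A n = γ_n(A,∘)` for `n ≥ 1`). -/
def gammaCirc (A : Type u) [SkewBrace A] : ℕ → Set A
  | 0 => Set.univ
  | 1 => Set.univ
  | (n+2) => ccl (ccommSet (gammaCirc A (n+1)) Set.univ)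

/-- The series `Γ̄_n(A)`: `Γ̄₁(A) = A`, `Γ̄_n(A) = ⟨A * Γ̄_{n-1}(A), [A, Γ̄_{n-1}(A)]·⟩·`. -/
def GammaBar (A : Type u) [SkewBrace A] : ℕ → Set A
  | 0 => Set.univ
  | 1 => Set.univ
  | (n+2) =>
      dcl (starSet Set.univ (GammaBar A (n+1)) ∪ dcommSet Set.univ (GammaBar A (n+1)))

/-- The annihilator series: `AnnS A n = Ann_n(A)`, with `Ann_0(A) = 1` and
`Ann_n(A) = {a | a*b, b*a, [a,b]· ∈ Ann_{n-1}(A) for all b}`. -/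
def AnnS (A : Type u) [SkewBrace A] : ℕ → Set A
  | 0 => {ident}
  | (n+1) => {a | ∀ b : A, bstar a b ∈ AnnS A n ∧ bstar b a ∈ AnnS A n ∧ dcomm a b ∈ AnnS A n}

/-- The alphabet `X = {γ·, γ̄·, *, *̄}` of brace commutator symbols. -/
inductive BWord : Type
  | g | gbar | s | sbar

/-- Evaluation of a single symbol of `X`. -/
def evalX : BWord → A → A → A
  | BWord.g => dcomm
  | BWord.gbar => fun a b => dcomm b a
  | BWord.s => bstar
  | BWord.sbar => fun a b => bstar b a

/-- `evalW e a n` is the value `m(a₀ a₁ ⋯ a_n)` of the degree-`n` brace commutator word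
`m = (e 0)(e 1)⋯(e (n-1))` on the arguments `a 0, …, a n`:
`m(a₀ ⋯ a_n) = (e 0)(a₀, (e 1)(a₁, …, (e (n-1))(a_{n-1}, a_n)⋯))`. -/
def evalW : (ℕ → BWord) → (ℕ → A) → ℕ → A
  | _, a, 0 => a 0
  | e, a, (n+1) => evalX (e 0) (a 0) (evalW (fun i => e (i+1)) (fun i => a (i+1)) n)

/-- `Asub A t = A_{(t)}`, the subgroup of `(A,·)` generated by all values of brace commutator
words of degree `≥ t`. -/
def Asub (A : Type u) [SkewBrace A] (t : ℕ) : Set A :=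
  dcl {x | ∃ s : ℕ, t ≤ s ∧ ∃ (e : ℕ → BWord) (a : ℕ → A), x = evalW e a s}

/-- `Sset A r = S_r(A)`, the set of all values of brace commutator words of degree exactly `r`
(`S_0(A) = A`). -/
def Sset (A : Type u) [SkewBrace A] (r : ℕ) : Set A :=
  {x | ∃ (e : ℕ → BWord) (a : ℕ → A), x = evalW e a r}

/-- `cosetRel I a b` says that `b` lies in the coset `I · a`. -/
def cosetRel (I : Set A) (a b : A) : Prop := ∃ c ∈ I, b = dmul c a

/-- The class `I_n`: the maps `φ_m : (A/Ann_n(A))^{n+1} → A_{(n)}`,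
`(Ann_n(A)a₁, …, Ann_n(A)a_{n+1}) ↦ m(a₁⋯a_{n+1})`, are well defined for every word `m` of
degree `n`. -/
def InClass (A : Type u) [SkewBrace A] (n : ℕ) : Prop :=
  ∀ (e : ℕ → BWord) (a b : ℕ → A),
    (∀ i : ℕ, i ≤ n → cosetRel (AnnS A n) (a i) (b i)) →
    evalW e b n = evalW e a n

/-- A skew left brace `(A,·,∘)` is symmetric if `(A,∘,·)` is also a skew left brace, i.e.
`a · (b ∘ c) = (a · b) ∘ ā ∘ (a · c)`. -/
def IsSymmetric (A : Type u) [SkewBrace A] : Prop :=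
  ∀ a b c : A, dmul a (cmul b c) = cmul (cmul (dmul a b) (cinv a)) (dmul a c)

/-- A sub-skew brace: a subset which is a subgroup of both `(A,·)` and `(A,∘)`. -/
structure IsSubBrace (A : Type u) [SkewBrace A] (S : Set A) : Prop where
  ident_mem : ident ∈ S
  dmul_mem : ∀ {x y : A}, x ∈ S → y ∈ S → dmul x y ∈ S
  dinv_mem : ∀ {x : A}, x ∈ S → dinv x ∈ S
  cmul_mem : ∀ {x y : A}, x ∈ S → y ∈ S → cmul x y ∈ S
  cinv_mem : ∀ {x : A}, x ∈ S → cinv x ∈ S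

/-- An ideal of a skew brace: a subgroup of `(A,·)`, normal in `(A,·)` and `(A,∘)`,
and invariant under all `λ_a`. -/
structure IsIdeal (A : Type u) [SkewBrace A] (I : Set A) : Prop where
  ident_mem : ident ∈ I
  dmul_mem : ∀ {x y : A}, x ∈ I → y ∈ I → dmul x y ∈ I
  dinv_mem : ∀ {x : A}, x ∈ I → dinv x ∈ I
  dconj_mem : ∀ (a : A) {x : A}, x ∈ I → dmul (dmul a x) (dinv a) ∈ I
  cconj_mem : ∀ (a : A) {x : A}, x ∈ I → cmul (cmul a x) (cinv a) ∈ I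
  lam_mem : ∀ (a : A) {x : A}, x ∈ I → lam a x ∈ I

/-- A homomorphism of skew braces. -/
structure IsBraceHom {A : Type u} {B : Type v} [SkewBrace A] [SkewBrace B] (f : A → B) : Prop where
  map_dmul : ∀ x y : A, f (dmul x y) = dmul (f x) (f y)
  map_cmul : ∀ x y : A, f (cmul x y) = cmul (f x) (f y)

/-- The data of an isoclinism of skew braces along ideals `I` of `A` and `J` of `B`:
`ξ` induces a brace isomorphism `A/I → B/J` and `θ` restricts to a brace isomorphism
`Γ₂(A) → Γ₂(B)` compatible with the commutator and star maps. -/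
structure IsoclinismData (A : Type u) (B : Type v) [SkewBrace A] [SkewBrace B]
    (I : Set A) (J : Set B) (ξ θ : A → B) : Prop where
  xi_resp : ∀ a a' : A, cosetRel I a a' ↔ cosetRel J (ξ a) (ξ a')
  xi_surj : ∀ b : B, ∃ a : A, cosetRel J b (ξ a)
  xi_dmul : ∀ a a' : A, cosetRel J (dmul (ξ a) (ξ a')) (ξ (dmul a a'))
  xi_cmul : ∀ a a' : A, cosetRel J (cmul (ξ a) (ξ a')) (ξ (cmul a a'))
  theta_maps : ∀ x ∈ Gamma A 2, θ x ∈ Gamma B 2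
  theta_inj : ∀ x ∈ Gamma A 2, ∀ y ∈ Gamma A 2, θ x = θ y → x = y
  theta_surj : ∀ y ∈ Gamma B 2, ∃ x ∈ Gamma A 2, θ x = y
  theta_dmul : ∀ x ∈ Gamma A 2, ∀ y ∈ Gamma A 2, θ (dmul x y) = dmul (θ x) (θ y)
  theta_cmul : ∀ x ∈ Gamma A 2, ∀ y ∈ Gamma A 2, θ (cmul x y) = cmul (θ x) (θ y)
  compat_dcomm : ∀ a₁ a₂ : A, ∀ b₁ b₂ : B, cosetRel J b₁ (ξ a₁) → cosetRel J b₂ (ξ a₂) →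
    θ (dcomm a₁ a₂) = dcomm b₁ b₂
  compat_star : ∀ a₁ a₂ : A, ∀ b₁ b₂ : B, cosetRel J b₁ (ξ a₁) → cosetRel J b₂ (ξ a₂) →
    θ (bstar a₁ a₂) = bstar b₁ b₂

/-- Isoclinism (1-isoclinism) of skew left braces. -/
def Isoclinic (A : Type u) (B : Type v) [SkewBrace A] [SkewBrace B] : Prop :=
  ∃ ξ θ : A → B, IsoclinismData A B (AnnS A 1) (AnnS B 1) ξ θ

/-- The data of an `n`-isoclinism of skew braces: `ξ` induces a brace isomorphism
`A/Ann_n(A) → B/Ann_n(B)` and `θ` restricts to a brace isomorphism `A_{(n)} → B_{(n)}`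
commuting with all brace commutator word maps of degree `n`. -/
structure IsoclinismDataN (A : Type u) (B : Type v) [SkewBrace A] [SkewBrace B]
    (n : ℕ) (ξ θ : A → B) : Prop where
  xi_resp : ∀ a a' : A, cosetRel (AnnS A n) a a' ↔ cosetRel (AnnS B n) (ξ a) (ξ a')
  xi_surj : ∀ b : B, ∃ a : A, cosetRel (AnnS B n) b (ξ a)
  xi_dmul : ∀ a a' : A, cosetRel (AnnS B n) (dmul (ξ a) (ξ a')) (ξ (dmul a a'))
  xi_cmul : ∀ a a' : A, cosetRel (AnnS B n) (cmul (ξ a) (ξ a')) (ξ (cmul a a'))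
  theta_maps : ∀ x ∈ Asub A n, θ x ∈ Asub B n
  theta_inj : ∀ x ∈ Asub A n, ∀ y ∈ Asub A n, θ x = θ y → x = y
  theta_surj : ∀ y ∈ Asub B n, ∃ x ∈ Asub A n, θ x = y
  theta_dmul : ∀ x ∈ Asub A n, ∀ y ∈ Asub A n, θ (dmul x y) = dmul (θ x) (θ y)
  theta_cmul : ∀ x ∈ Asub A n, ∀ y ∈ Asub A n, θ (cmul x y) = cmul (θ x) (θ y)
  compat : ∀ (e : ℕ → BWord) (a : ℕ → A) (b : ℕ → B),
    (∀ i : ℕ, i ≤ n → cosetRel (AnnS B n) (b i) (ξ (a i))) →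
    θ (evalW e a n) = evalW e b n

/-- `n`-isoclinism of skew left braces. -/
def IsoclinicN (A : Type u) (B : Type v) [SkewBrace A] [SkewBrace B] (n : ℕ) : Prop :=
  ∃ ξ θ : A → B, IsoclinismDataN A B n ξ θ

/-- The product set `S · T = {s · t : s ∈ S, t ∈ T}` in `(A,·)`. -/
def setDProd (S T : Set A) : Set A := {x | ∃ s ∈ S, ∃ t ∈ T, x = dmul s t}

/-- The product set `S ∘ T = {s ∘ t : s ∈ S, t ∈ T}` in `(A,∘)`. -/
def setCProd (S T : Set A) : Set A := {x | ∃ s ∈ S, ∃ t ∈ T, x = cmul s t}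

/-- The skew brace structure on a sub-skew brace. -/
def subBrace (S : Set A) (h : IsSubBrace A S) : SkewBrace S where
  dmul x y := ⟨dmul x.1 y.1, h.dmul_mem x.2 y.2⟩
  ident := ⟨ident, h.ident_mem⟩
  dinv x := ⟨dinv x.1, h.dinv_mem x.2⟩
  cmul x y := ⟨cmul x.1 y.1, h.cmul_mem x.2 y.2⟩
  cinv x := ⟨cinv x.1, h.cinv_mem x.2⟩
  dmul_assoc a b c := Subtype.ext (dmul_assoc a.1 b.1 c.1)
  ident_dmul a := Subtype.ext (ident_dmul a.1)
  dmul_ident a := Subtype.ext (dmul_ident a.1)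
  dinv_dmul a := Subtype.ext (dinv_dmul a.1)
  dmul_dinv a := Subtype.ext (dmul_dinv a.1)
  cmul_assoc a b c := Subtype.ext (cmul_assoc a.1 b.1 c.1)
  ident_cmul a := Subtype.ext (ident_cmul a.1)
  cmul_ident a := Subtype.ext (cmul_ident a.1)
  cinv_cmul a := Subtype.ext (cinv_cmul a.1)
  cmul_cinv a := Subtype.ext (cmul_cinv a.1)
  compat a b c := Subtype.ext (compat a.1 b.1 c.1)

/-- The direct product of two skew braces, with componentwise operations. -/
instance prodBrace (A : Type u) (B : Type v) [SkewBrace A] [SkewBrace B] :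
    SkewBrace (A × B) where
  dmul p q := (dmul p.1 q.1, dmul p.2 q.2)
  ident := (ident, ident)
  dinv p := (dinv p.1, dinv p.2)
  cmul p q := (cmul p.1 q.1, cmul p.2 q.2)
  cinv p := (cinv p.1, cinv p.2)
  dmul_assoc a b c := Prod.ext_iff.mpr ⟨dmul_assoc _ _ _, dmul_assoc _ _ _⟩
  ident_dmul a := Prod.ext_iff.mpr ⟨ident_dmul _, ident_dmul _⟩
  dmul_ident a := Prod.ext_iff.mpr ⟨dmul_ident _, dmul_ident _⟩
  dinv_dmul a := Prod.ext_iff.mpr ⟨dinv_dmul _, dinv_dmul _⟩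
  dmul_dinv a := Prod.ext_iff.mpr ⟨dmul_dinv _, dmul_dinv _⟩
  cmul_assoc a b c := Prod.ext_iff.mpr ⟨cmul_assoc _ _ _, cmul_assoc _ _ _⟩
  ident_cmul a := Prod.ext_iff.mpr ⟨ident_cmul _, ident_cmul _⟩
  cmul_ident a := Prod.ext_iff.mpr ⟨cmul_ident _, cmul_ident _⟩
  cinv_cmul a := Prod.ext_iff.mpr ⟨cinv_cmul _, cinv_cmul _⟩
  cmul_cinv a := Prod.ext_iff.mpr ⟨cmul_cinv _, cmul_cinv _⟩
  compat a b c := Prod.ext_iff.mpr ⟨compat _ _ _, compat _ _ _⟩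

end SkewBrace

namespace SkewBrace

section Basic

variable {A : Type u} [SkewBrace A]

theorem dinv_dmul_cancel_left (a b : A) : dmul (dinv a) (dmul a b) = b := by
  rw [← dmul_assoc, dinv_dmul, ident_dmul]

theorem dmul_dinv_cancel_left (a b : A) : dmul a (dmul (dinv a) b) = b := by
  rw [← dmul_assoc, dmul_dinv, ident_dmul]

theorem dmul_left_cancel {a b c : A} (h : dmul a b = dmul a c) : b = c := by
  rw [← dinv_dmul_cancel_left a b, h, dinv_dmul_cancel_left]

theorem dmul_right_cancel {a b c : A} (h : dmul b a = dmul c a) : b = c := by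
  rw [← dmul_ident b, ← dmul_dinv a, ← dmul_assoc, h, dmul_assoc, dmul_dinv, dmul_ident]

theorem dmul_dinv_eq_ident_iff {a b : A} : dmul a (dinv b) = ident ↔ a = b := by
  rw [← dmul_dinv b]
  exact ⟨dmul_right_cancel, fun h => by rw [h]⟩

theorem dinv_dmul_rev (a b : A) : dinv (dmul a b) = dmul (dinv b) (dinv a) := by
  apply dmul_left_cancel (a := dmul a b)
  rw [dmul_dinv, dmul_assoc, dmul_dinv_cancel_left, dmul_dinv]

theorem lam_eq_iff {a b c : A} : lam a b = c ↔ cmul a b = dmul a c := by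
  constructor
  · rintro rfl
    exact (dmul_dinv_cancel_left _ _).symm
  · intro h
    rw [lam, h, dinv_dmul_cancel_left]

theorem lam_dmul (a b c : A) : lam a (dmul b c) = dmul (lam a b) (lam a c) := by
  simp only [lam, compat, dmul_assoc]

theorem bstar_eq_ident_iff {a b : A} : bstar a b = ident ↔ cmul a b = dmul a b := by
  rw [bstar, dmul_dinv_eq_ident_iff, lam_eq_iff]

theorem dcomm_eq_ident_iff {a b : A} : dcomm a b = ident ↔ dmul a b = dmul b a := by
  rw [dcomm, dmul_dinv_eq_ident_iff]
  constructor
  · intro h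
    conv_rhs => rw [← h, dmul_assoc, dinv_dmul, dmul_ident]
  · intro h
    rw [h, dmul_assoc, dmul_dinv, dmul_ident]

theorem mem_AnnS_one_iff {c : A} : c ∈ AnnS A 1 ↔
    ∀ b : A, bstar c b = ident ∧ bstar b c = ident ∧ dcomm c b = ident := Iff.rfl

/-- An element lies in `Ann(A)` iff it is central in `(A,·)` and its circle products on either
side are its dot products. -/
theorem mem_AnnS_one_iff_mul {c : A} : c ∈ AnnS A 1 ↔
    ∀ b : A, cmul c b = dmul c b ∧ cmul b c = dmul b c ∧ dmul c b = dmul b c := by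
  simp only [mem_AnnS_one_iff, bstar_eq_ident_iff, dcomm_eq_ident_iff]

theorem cmul_eq_dmul_of_mem_AnnS {c : A} (hc : c ∈ AnnS A 1) (b : A) : cmul c b = dmul c b :=
  (mem_AnnS_one_iff_mul.1 hc b).1

theorem cmul_eq_dmul_of_mem_AnnS' {c : A} (hc : c ∈ AnnS A 1) (b : A) : cmul b c = dmul b c :=
  (mem_AnnS_one_iff_mul.1 hc b).2.1

theorem dmul_comm_of_mem_AnnS {c : A} (hc : c ∈ AnnS A 1) (b : A) : dmul c b = dmul b c :=
  (mem_AnnS_one_iff_mul.1 hc b).2.2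

theorem lam_eq_self_of_mem_AnnS {c : A} (hc : c ∈ AnnS A 1) (a : A) : lam a c = c :=
  lam_eq_iff.2 (cmul_eq_dmul_of_mem_AnnS' hc a)

theorem ident_mem_AnnS_one : (ident : A) ∈ AnnS A 1 :=
  mem_AnnS_one_iff_mul.2 fun b => by
    simp only [ident_cmul, ident_dmul, cmul_ident, dmul_ident, and_self]

theorem dmul_mem_AnnS_one {x y : A} (hx : x ∈ AnnS A 1) (hy : y ∈ AnnS A 1) :
    dmul x y ∈ AnnS A 1 := by
  refine mem_AnnS_one_iff_mul.2 fun b => ⟨?_, ?_, ?_⟩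
  · rw [← cmul_eq_dmul_of_mem_AnnS hx y, cmul_assoc, cmul_eq_dmul_of_mem_AnnS hx,
      cmul_eq_dmul_of_mem_AnnS hx, cmul_eq_dmul_of_mem_AnnS hy, dmul_assoc]
  · rw [compat, cmul_eq_dmul_of_mem_AnnS' hx, cmul_eq_dmul_of_mem_AnnS' hy, dmul_assoc,
      dinv_dmul_cancel_left, dmul_assoc]
  · rw [dmul_assoc, dmul_comm_of_mem_AnnS hy, ← dmul_assoc, dmul_comm_of_mem_AnnS hx, dmul_assoc]

theorem dinv_mem_AnnS_one {x : A} (hx : x ∈ AnnS A 1) : dinv x ∈ AnnS A 1 := by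
  refine mem_AnnS_one_iff_mul.2 fun b => ⟨?_, ?_, ?_⟩
  · apply dmul_left_cancel (a := x)
    rw [← cmul_eq_dmul_of_mem_AnnS hx, ← cmul_assoc, cmul_eq_dmul_of_mem_AnnS hx (dinv x),
      dmul_dinv, ident_cmul, dmul_dinv_cancel_left]
  · apply dmul_right_cancel (a := x)
    have h := compat b (dinv x) x
    rw [dinv_dmul, cmul_ident, cmul_eq_dmul_of_mem_AnnS' hx b, dmul_assoc,
      dinv_dmul_cancel_left] at h
    rw [← h, dmul_assoc, dinv_dmul, dmul_ident]
  · apply dmul_left_cancel (a := x)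
    rw [dmul_dinv_cancel_left, ← dmul_assoc, dmul_comm_of_mem_AnnS hx, dmul_assoc, dmul_dinv,
      dmul_ident]

theorem isIdeal_AnnS_one : IsIdeal A (AnnS A 1) where
  ident_mem := ident_mem_AnnS_one
  dmul_mem := dmul_mem_AnnS_one
  dinv_mem := dinv_mem_AnnS_one
  dconj_mem a x hx := by
    rwa [← dmul_comm_of_mem_AnnS hx, dmul_assoc, dmul_dinv, dmul_ident]
  cconj_mem a x hx := by
    rwa [cmul_eq_dmul_of_mem_AnnS' hx, ← dmul_comm_of_mem_AnnS hx,
      ← cmul_eq_dmul_of_mem_AnnS hx, cmul_assoc, cmul_cinv, cmul_ident]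
  lam_mem a x hx := by rwa [lam_eq_self_of_mem_AnnS hx]

theorem dmul_mem_AnnS_one_iff {x y : A} (hx : x ∈ AnnS A 1) :
    dmul x y ∈ AnnS A 1 ↔ y ∈ AnnS A 1 := by
  refine ⟨fun h => ?_, dmul_mem_AnnS_one hx⟩
  simpa only [dinv_dmul_cancel_left] using dmul_mem_AnnS_one (dinv_mem_AnnS_one hx) h

theorem dmul_left_comm_of_mem_AnnS {c : A} (hc : c ∈ AnnS A 1) (a b : A) :
    dmul a (dmul c b) = dmul c (dmul a b) := by
  rw [← dmul_assoc, ← dmul_comm_of_mem_AnnS hc, dmul_assoc]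

theorem dcomm_dmul_of_mem_AnnS {c d : A} (hc : c ∈ AnnS A 1) (hd : d ∈ AnnS A 1) (a b : A) :
    dcomm (dmul c a) (dmul d b) = dcomm a b := by
  have hc' := dmul_left_comm_of_mem_AnnS (dinv_mem_AnnS_one hc)
  have hd' := dmul_left_comm_of_mem_AnnS (dinv_mem_AnnS_one hd)
  simp only [dcomm, dinv_dmul_rev, dmul_assoc]
  rw [hc' (dinv a), hc' b, hc' d, hc' a, dmul_dinv_cancel_left,
    ← dmul_comm_of_mem_AnnS (dinv_mem_AnnS_one hd), hd' (dinv a), hd' b, dmul_dinv_cancel_left]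

theorem lam_dmul_left_of_mem_AnnS {c : A} (hc : c ∈ AnnS A 1) (a b : A) :
    lam (dmul c a) b = lam a b := by
  rw [lam_eq_iff, ← cmul_eq_dmul_of_mem_AnnS hc, cmul_assoc, cmul_eq_dmul_of_mem_AnnS hc,
    cmul_eq_dmul_of_mem_AnnS hc, dmul_assoc, lam_eq_iff.1 rfl]

theorem bstar_dmul_of_mem_AnnS {c d : A} (hc : c ∈ AnnS A 1) (hd : d ∈ AnnS A 1) (a b : A) :
    bstar (dmul c a) (dmul d b) = bstar a b := by
  rw [bstar, lam_dmul_left_of_mem_AnnS hc, lam_dmul, lam_eq_self_of_mem_AnnS hd, dinv_dmul_rev,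
    dmul_comm_of_mem_AnnS hd, dmul_assoc, ← dmul_comm_of_mem_AnnS (dinv_mem_AnnS_one hd),
    dmul_dinv_cancel_left, bstar]

theorem cosetRel.mono {I J : Set A} (hIJ : I ⊆ J) {a b : A} (h : cosetRel I a b) :
    cosetRel J a b :=
  h.imp fun _ hc => ⟨hIJ hc.1, hc.2⟩

theorem cosetRel_refl {I : Set A} (hI : ident ∈ I) (a : A) : cosetRel I a a :=
  ⟨ident, hI, (ident_dmul a).symm⟩

theorem cosetRel_iff {I : Set A} {a b : A} : cosetRel I a b ↔ dmul b (dinv a) ∈ I := by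
  constructor
  · rintro ⟨c, hc, rfl⟩
    rwa [dmul_assoc, dmul_dinv, dmul_ident]
  · exact fun h => ⟨_, h, by rw [dmul_assoc, dinv_dmul, dmul_ident]⟩

theorem ident_mem_Gamma_two : (ident : A) ∈ Gamma A 2 := dclosure.one

theorem bstar_mem_Gamma_two (a b : A) : bstar a b ∈ Gamma A 2 :=
  dclosure.mem (Or.inl (Or.inl ⟨a, trivial, b, trivial, rfl⟩))

theorem dcomm_mem_Gamma_two (a b : A) : dcomm a b ∈ Gamma A 2 :=
  dclosure.mem (Or.inr ⟨a, trivial, b, trivial, rfl⟩)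

end Basic

namespace IsoclinismData

variable {A : Type u} {B : Type v} [SkewBrace A] [SkewBrace B] {L : Set A} {N : Set B}
  {ξ θ : A → B}

theorem theta_eq_ident_iff (h : IsoclinismData A B L N ξ θ) {x : A} (hx : x ∈ Gamma A 2) :
    θ x = ident ↔ x = ident := by
  have h1 : θ ident = ident := by
    apply dmul_left_cancel (a := θ ident)
    rw [← h.theta_dmul _ ident_mem_Gamma_two _ ident_mem_Gamma_two, ident_dmul, dmul_ident]
  constructor
  · exact fun e => h.theta_inj _ hx _ ident_mem_Gamma_two (e.trans h1.symm)
  · rintro rfl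
    exact h1

theorem xi_mem_AnnS_one_iff (h : IsoclinismData A B L N ξ θ) (hN : ident ∈ N) {c : A} :
    ξ c ∈ AnnS B 1 ↔ c ∈ AnnS A 1 := by
  have hc := cosetRel_refl hN (ξ c)
  have key : ∀ a b, cosetRel N b (ξ a) →
      ((bstar (ξ c) b = ident ∧ bstar b (ξ c) = ident ∧ dcomm (ξ c) b = ident) ↔
        (bstar c a = ident ∧ bstar a c = ident ∧ dcomm c a = ident)) := by
    intro a b hb
    rw [← h.compat_star _ _ _ _ hc hb, ← h.compat_star _ _ _ _ hb hc,
      ← h.compat_dcomm _ _ _ _ hc hb, h.theta_eq_ident_iff (bstar_mem_Gamma_two _ _),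
      h.theta_eq_ident_iff (bstar_mem_Gamma_two _ _),
      h.theta_eq_ident_iff (dcomm_mem_Gamma_two _ _)]
  rw [mem_AnnS_one_iff, mem_AnnS_one_iff]
  constructor
  · exact fun H a => (key a _ (cosetRel_refl hN _)).1 (H _)
  · intro H b
    obtain ⟨a, ha⟩ := h.xi_surj b
    exact (key a b ha).2 (H a)

/-- An isoclinism along ideals contained in the annihilators is an isoclinism along the
annihilators, with the same maps. -/
theorem to_AnnS_one (h : IsoclinismData A B L N ξ θ) (hN : ident ∈ N) (hN' : N ⊆ AnnS B 1) :
    IsoclinismData A B (AnnS A 1) (AnnS B 1) ξ θ where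
  xi_resp a a' := by
    obtain ⟨n, hn, e⟩ := h.xi_dmul (dmul a' (dinv a)) a
    rw [dmul_assoc, dinv_dmul, dmul_ident] at e
    rw [cosetRel_iff, cosetRel_iff, e, ← dmul_assoc, dmul_assoc, dmul_dinv, dmul_ident,
      dmul_mem_AnnS_one_iff (hN' hn), h.xi_mem_AnnS_one_iff hN]
  xi_surj b := (h.xi_surj b).imp fun _ => cosetRel.mono hN'
  xi_dmul a a' := (h.xi_dmul a a').mono hN'
  xi_cmul a a' := (h.xi_cmul a a').mono hN'
  theta_maps := h.theta_maps
  theta_inj := h.theta_inj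
  theta_surj := h.theta_surj
  theta_dmul := h.theta_dmul
  theta_cmul := h.theta_cmul
  compat_dcomm := by
    rintro a₁ a₂ b₁ b₂ ⟨c, hc, e₁⟩ ⟨d, hd, e₂⟩
    rw [h.compat_dcomm a₁ a₂ _ _ (cosetRel_refl hN _) (cosetRel_refl hN _), e₁, e₂,
      dcomm_dmul_of_mem_AnnS hc hd]
  compat_star := by
    rintro a₁ a₂ b₁ b₂ ⟨c, hc, e₁⟩ ⟨d, hd, e₂⟩
    rw [h.compat_star a₁ a₂ _ _ (cosetRel_refl hN _) (cosetRel_refl hN _), e₁, e₂,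
      bstar_dmul_of_mem_AnnS hc hd]

end IsoclinismData

end SkewBrace

open SkewBrace in
/-- Two skew braces `A` and `B` are isoclinic if and only if there exist ideals `L ⊆ Ann(A)`
and `N ⊆ Ann(B)` and isomorphisms `ξ : A/L → B/N`, `θ : Γ₂(A) → Γ₂(B)` compatible with the
commutator and star maps. -/
theorem isoclinic_iff_ideal_data {A : Type u} {B : Type v} [SkewBrace A] [SkewBrace B] :
    Isoclinic A B ↔
      ∃ (L : Set A) (N : Set B) (ξ θ : A → B),
        IsIdeal A L ∧ L ⊆ AnnS A 1 ∧ IsIdeal B N ∧ N ⊆ AnnS B 1 ∧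
        IsoclinismData A B L N ξ θ := by
  constructor
  · rintro ⟨ξ, θ, h⟩
    exact ⟨_, _, ξ, θ, isIdeal_AnnS_one, subset_rfl, isIdeal_AnnS_one, subset_rfl, h⟩
  · rintro ⟨L, N, ξ, θ, -, -, hN, hN', h⟩
    exact ⟨ξ, θ, h.to_AnnS_one hN.ident_mem hN'⟩
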